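/- arXiv:2512.24807 — 2 statements merged into one kernel-verified Lean document; each statement's English description precedes it below -/
import Mathlib

section
/- Assume α ∈ (0,2) and 0 < β₁ < min(α, d−λ, q'), where ∂D satisfies the covering condition with exponent λ ∈ [0,d) and the Aikawa condition with exponent q' ∈ (0,d]. For a Borel function u : D → ℝ and ρ > 0 put E(u) := ∫_{D×D} (u(x)−u(y))² J(x,y) dx dy and E^{(ρ)}(u) := ∫_{{(x,y) ∈ D×D : |x−y| < ρ}} (u(x)−u(y))² J(x,y) dx dy. Then there exists C > 0 such that for every ρ ∈ (0, diam(D)) and every bounded Borel function u : D → ℝ with compact support, E(u) ≤ C ( E^{(ρ)}(u) + (min(ρ, R₀))^{−α} ∫_D u(x)² dx ). -/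
open MeasureTheory Metric Set ENNReal Filter

noncomputable def deltaD {d : ℕ} (D : Set (EuclideanSpace ℝ (Fin d)))
    (x : EuclideanSpace ℝ (Fin d)) : ℝ :=
  Metric.infDist x (frontier D)

def Aikawa {d : ℕ} (D : Set (EuclideanSpace ℝ (Fin d))) (q : ℝ) : Prop :=
  ∃ C₀ : ℝ, 1 ≤ C₀ ∧ ∀ x ∈ frontier D, ∀ r s : ℝ, 0 < s → s ≤ r →
    ENNReal.ofReal r < EMetric.diam (frontier D) →
    MeasureTheory.volume {y : EuclideanSpace ℝ (Fin d) |
        y ∈ Metric.ball x r ∧ Metric.infDist y (frontier D) < s} ≤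
      ENNReal.ofReal (C₀ * (s / r) ^ q) * MeasureTheory.volume (Metric.ball x r)

noncomputable def truncMin (A : ℝ≥0∞) (r : ℝ) : ℝ := (min (ENNReal.ofReal r) A).toReal

def CoveringCond {d : ℕ} (D : Set (EuclideanSpace ℝ (Fin d))) (lam : ℝ) : Prop :=
  ∃ C_A : ℝ, 1 ≤ C_A ∧ ∀ Q ∈ frontier D, ∀ a b : ℝ, 0 < a → a ≤ b →
    ∃ F : Finset (EuclideanSpace ℝ (Fin d)), (↑F : Set (EuclideanSpace ℝ (Fin d))) ⊆ frontier D ∧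
      (F.card : ℝ) ≤ C_A * (b / a) ^ lam ∧
      Metric.ball Q b ∩ frontier D ⊆ ⋃ p ∈ F, Metric.ball p a

/-- Volume of a ball as a multiple of the volume of the unit ball. -/
lemma volume_ball_eq_ofReal {d : ℕ} (x : EuclideanSpace ℝ (Fin d)) {r : ℝ} (hr : 0 < r) :
    volume (ball x r) =
      ENNReal.ofReal (r ^ d * (volume (ball (0 : EuclideanSpace ℝ (Fin d)) 1)).toReal) := by
  rw [Measure.addHaar_ball_of_pos _ _ hr, finrank_euclideanSpace_fin,
    ENNReal.ofReal_mul (by positivity), ENNReal.ofReal_toReal measure_ball_lt_top.ne]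

lemma tsum_ofReal_geometric {c q : ℝ} (hc : 0 ≤ c) (hq0 : 0 ≤ q) (hq1 : q < 1) :
    ∑' n : ℕ, ENNReal.ofReal (c * q ^ n) = ENNReal.ofReal (c / (1 - q)) := by
  rw [← ENNReal.ofReal_tsum_of_nonneg (fun n => by positivity)
    ((summable_geometric_of_lt_one hq0 hq1).mul_left c), tsum_mul_left,
    tsum_geometric_of_lt_one hq0 hq1, div_eq_mul_inv]

/-- The covering condition bounds the volume of neighbourhoods of the boundary. -/
lemma volume_near_frontier_le {d : ℕ} {D : Set (EuclideanSpace ℝ (Fin d))}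
    (hfr : (frontier D).Nonempty) {lam : ℝ} (hCov : CoveringCond D lam) :
    ∃ C : ℝ, 0 ≤ C ∧ ∀ (x : EuclideanSpace ℝ (Fin d)) (a b : ℝ), 0 < a → a ≤ b →
      volume {y | y ∈ ball x b ∧ infDist y (frontier D) < a} ≤
        ENNReal.ofReal (C * (a / b) ^ ((d : ℝ) - lam) * b ^ d) := by
  obtain ⟨C_A, hC_A, hcov⟩ := hCov
  set ω : ℝ := (volume (ball (0 : EuclideanSpace ℝ (Fin d)) 1)).toReal with hω
  refine ⟨C_A * 5 ^ lam * 2 ^ d * ω, by positivity, fun x a b ha hab => ?_⟩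
  have hb : 0 < b := ha.trans_le hab
  rcases Set.eq_empty_or_nonempty {y | y ∈ ball x b ∧ infDist y (frontier D) < a} with h | h
  · rw [h]; simp
  obtain ⟨y₀, hy₀, hy₀a⟩ := h
  obtain ⟨Q, hQ, hQd⟩ := (infDist_lt_iff hfr).1 hy₀a
  obtain ⟨F, -, hFcard, hFcov⟩ := hcov Q hQ a (5 * b) ha (by linarith)
  have hsub : {y | y ∈ ball x b ∧ infDist y (frontier D) < a} ⊆ ⋃ p ∈ F, ball p (2 * a) := by
    rintro y ⟨hy, hya⟩
    obtain ⟨p, hp, hpd⟩ := (infDist_lt_iff hfr).1 hya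
    have hpQ : p ∈ ball Q (5 * b) := by
      rw [mem_ball] at *
      have h1 := dist_triangle4 p y x y₀
      have h2 := dist_triangle p y₀ Q
      rw [dist_comm p y, dist_comm x y₀] at h1
      linarith
    obtain ⟨c, hc, hpc⟩ := mem_iUnion₂.1 (hFcov ⟨hpQ, hp⟩)
    refine mem_iUnion₂.2 ⟨c, hc, ?_⟩
    rw [mem_ball] at *
    linarith [dist_triangle y p c]
  have hcard : (∑ p ∈ F, volume (ball p (2 * a))) =
      ENNReal.ofReal (F.card * ((2 * a) ^ d * ω)) := by
    rw [Finset.sum_congr rfl fun p _ => volume_ball_eq_ofReal p (by positivity : 0 < 2 * a),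
      Finset.sum_const, nsmul_eq_mul, ENNReal.ofReal_mul (p := (F.card : ℝ)) (by positivity),
      ENNReal.ofReal_natCast]
  refine (measure_mono hsub).trans ((measure_biUnion_finset_le F _).trans ?_)
  rw [hcard]
  refine ENNReal.ofReal_le_ofReal ?_
  calc (F.card : ℝ) * ((2 * a) ^ d * ω) ≤ C_A * (5 * b / a) ^ lam * ((2 * a) ^ d * ω) := by gcongr
    _ = C_A * 5 ^ lam * 2 ^ d * ω * (a / b) ^ ((d : ℝ) - lam) * b ^ d := by
      have h5 : 5 * b / a = 5 * (a / b)⁻¹ := by field_simp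
      rw [h5, Real.mul_rpow (by norm_num) (by positivity), Real.inv_rpow (by positivity),
        Real.rpow_sub (by positivity), Real.rpow_natCast, div_pow, mul_pow]
      have : (a / b) ^ lam ≠ 0 := (Real.rpow_pos_of_pos (by positivity) _).ne'
      field_simp

/-- A negative power of the distance to the boundary is integrable on balls, uniformly. -/
lemma lintegral_ball_max_div_infDist_le {d : ℕ} {D : Set (EuclideanSpace ℝ (Fin d))}
    (hfr : (frontier D).Nonempty) {lam β : ℝ} (hCov : CoveringCond D lam) (hβ : 0 ≤ β)
    (hβlam : β < (d : ℝ) - lam) :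
    ∃ K : ℝ, 0 ≤ K ∧ ∀ (x : EuclideanSpace ℝ (Fin d)) (s : ℝ), 0 < s →
      ∫⁻ y in ball x s, ENNReal.ofReal ((max 1 (s / infDist y (frontier D))) ^ β) ≤
        ENNReal.ofReal (K * s ^ d) := by
  obtain ⟨C, hC, hvol⟩ := volume_near_frontier_le hfr hCov
  set ω : ℝ := (volume (ball (0 : EuclideanSpace ℝ (Fin d)) 1)).toReal with hω
  set q : ℝ := 2 ^ (β - ((d : ℝ) - lam)) with hq
  have hq0 : 0 < q := by positivity
  have hq1 : q < 1 := Real.rpow_lt_one_of_one_lt_of_neg (by norm_num) (by linarith)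
  have hq1' : 0 < 1 - q := by linarith
  refine ⟨ω + 2 ^ β * C * 2 ^ d / (1 - q), by positivity, fun x s hs => ?_⟩
  set S : ℕ → Set (EuclideanSpace ℝ (Fin d)) :=
    fun n => {y | infDist y (frontier D) < 2 * s * (2 ^ n)⁻¹} with hS
  have hSmeas : ∀ n, MeasurableSet (S n) := fun n =>
    measurableSet_lt (continuous_infDist_pt _).measurable measurable_const
  have hpt : ∀ y, ENNReal.ofReal ((max 1 (s / infDist y (frontier D))) ^ β) ≤
      1 + ∑' n : ℕ, (S n).indicator (fun _ => ENNReal.ofReal (2 ^ β * (2 ^ β) ^ n)) y := by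
    intro y
    rcases le_or_gt (s / infDist y (frontier D)) 1 with h | h
    · rw [max_eq_left h, Real.one_rpow, ENNReal.ofReal_one]
      exact le_self_add
    have hδ : 0 < infDist y (frontier D) := by
      by_contra h0
      rw [le_antisymm (not_lt.1 h0) infDist_nonneg, _root_.div_zero] at h
      linarith
    obtain ⟨n, hn1, hn2⟩ := exists_nat_pow_near h.le (one_lt_two : (1 : ℝ) < 2)
    have hyS : y ∈ S n := by
      rw [le_div_iff₀ hδ, mul_comm, ← le_div_iff₀ (by positivity)] at hn1
      simp only [hS, mem_ofPred_eq]
      rw [← div_eq_mul_inv, mul_div_assoc]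
      have : 0 < s / 2 ^ n := by positivity
      linarith
    refine le_trans ?_ (le_trans (ENNReal.le_tsum n) le_add_self)
    rw [indicator_of_mem hyS, max_eq_right h.le]
    refine ENNReal.ofReal_le_ofReal ?_
    calc (s / infDist y (frontier D)) ^ β ≤ (2 ^ (n + 1) : ℝ) ^ β := by gcongr
      _ = 2 ^ β * (2 ^ β) ^ n := by
        rw [pow_succ, Real.mul_rpow (by positivity) (by positivity),
          Real.rpow_pow_comm (by norm_num), mul_comm]
  have hterm : ∀ n : ℕ, ENNReal.ofReal (2 ^ β * (2 ^ β) ^ n) * volume (S n ∩ ball x s) ≤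
      ENNReal.ofReal (2 ^ β * C * (2 * s) ^ d * q ^ n) := by
    intro n
    have h1 : volume (S n ∩ ball x s) ≤
        ENNReal.ofReal (C * ((2 ^ n)⁻¹) ^ ((d : ℝ) - lam) * (2 * s) ^ d) := by
      have h2 := hvol x (2 * s * (2 ^ n)⁻¹) (2 * s) (by positivity)
        (mul_le_of_le_one_right (by positivity) (inv_le_one_of_one_le₀ (one_le_pow₀ (by norm_num))))
      rw [mul_div_cancel_left₀ _ (by positivity : 2 * s ≠ 0)] at h2
      refine (measure_mono ?_).trans h2
      rintro y ⟨hyS, hyb⟩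
      exact ⟨ball_subset_ball (by linarith) hyb, hyS⟩
    refine (mul_le_mul_right h1 _).trans ?_
    rw [← ENNReal.ofReal_mul (by positivity)]
    refine ENNReal.ofReal_le_ofReal (le_of_eq ?_)
    have h3 : q ^ n = (2 ^ β) ^ n * ((2 ^ n : ℝ)⁻¹) ^ ((d : ℝ) - lam) := by
      rw [hq, Real.rpow_sub (by norm_num), div_pow, Real.inv_rpow (by positivity), div_eq_mul_inv]
      congr 2
      rw [Real.rpow_pow_comm (by norm_num)]
    rw [h3]
    ring
  calc ∫⁻ y in ball x s, ENNReal.ofReal ((max 1 (s / infDist y (frontier D))) ^ β)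
      ≤ ∫⁻ y in ball x s, (1 + ∑' n : ℕ,
          (S n).indicator (fun _ => ENNReal.ofReal (2 ^ β * (2 ^ β) ^ n)) y) :=
        lintegral_mono hpt
    _ = volume (ball x s) +
          ∑' n : ℕ, ENNReal.ofReal (2 ^ β * (2 ^ β) ^ n) * volume (S n ∩ ball x s) := by
        rw [lintegral_add_left measurable_const, lintegral_one, Measure.restrict_apply_univ,
          lintegral_tsum fun n => (measurable_const.indicator (hSmeas n)).aemeasurable]
        congr 2
        funext n
        rw [lintegral_indicator_const (hSmeas n), Measure.restrict_apply (hSmeas n)]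
    _ ≤ ENNReal.ofReal (s ^ d * ω) + ∑' n : ℕ, ENNReal.ofReal (2 ^ β * C * (2 * s) ^ d * q ^ n) := by
        rw [volume_ball_eq_ofReal x hs]
        gcongr with n
        exact hterm n
    _ = ENNReal.ofReal ((ω + 2 ^ β * C * 2 ^ d / (1 - q)) * s ^ d) := by
        rw [tsum_ofReal_geometric (by positivity) hq0.le hq1,
          ← ENNReal.ofReal_add (by positivity) (by positivity), mul_pow]
        congr 1
        ring

section truncMin

variable {A : ℝ≥0∞} {a b k : ℝ}

lemma truncMin_mono (hab : a ≤ b) : truncMin A a ≤ truncMin A b :=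
  ENNReal.toReal_mono ((min_le_left _ _).trans_lt ofReal_lt_top).ne
    (min_le_min_right _ (ENNReal.ofReal_le_ofReal hab))

lemma truncMin_pos (hA : 0 < A) (ha : 0 < a) : 0 < truncMin A a :=
  ENNReal.toReal_pos (lt_min (ENNReal.ofReal_pos.2 ha) hA).ne'
    ((min_le_left _ _).trans_lt ofReal_lt_top).ne

lemma truncMin_mul_le (hk : 1 ≤ k) : truncMin A (k * a) ≤ k * truncMin A a := by
  have hk0 : 0 ≤ k := by linarith
  unfold truncMin
  rw [← ENNReal.toReal_ofReal hk0, ← ENNReal.toReal_mul, ENNReal.toReal_ofReal hk0]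
  refine ENNReal.toReal_mono (ENNReal.mul_ne_top ofReal_ne_top
    ((min_le_left _ _).trans_lt ofReal_lt_top).ne) ?_
  rw [ENNReal.ofReal_mul hk0, mul_min]
  refine min_le_min_left _ (le_mul_of_one_le_left' ?_)
  rwa [ENNReal.one_le_ofReal]

lemma truncMin_div_le (hA : 0 < A) (hb : 0 < b) :
    truncMin A a / truncMin A b ≤ max 1 (a / b) := by
  rw [div_le_iff₀ (truncMin_pos hA hb)]
  refine le_trans ?_ (truncMin_mul_le (le_max_left _ _))
  refine truncMin_mono ?_
  calc a = a / b * b := by field_simp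
    _ ≤ max 1 (a / b) * b := by gcongr; exact le_max_right _ _

lemma continuous_truncMin : Continuous (truncMin A) := by
  refine continuous_iff_continuousAt.2 fun a => ?_
  exact (ENNReal.tendsto_toReal ((min_le_left _ _).trans_lt ofReal_lt_top).ne).comp
    ((ENNReal.continuous_ofReal.min continuous_const).tendsto a)

end truncMin

section boundaryWeight

variable {Φ : ℝ → ℝ} {β C : ℝ} {A : ℝ≥0∞} {r t δ η : ℝ}

/-- Moving one endpoint of a long jump costs at most a power of the boundary distance. -/
lemma weight_long_jump_le (hΦmono : MonotoneOn Φ (Ici 0))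
    (hscale : ∀ s r : ℝ, 0 < s → s ≤ r → Φ r ≤ C * (r / s) ^ β * Φ s) (hA : 0 < A)
    (hr : 0 < r) (hrt : r ≤ t) (hδ : 0 < δ) (hη : 0 < η) :
    Φ (truncMin A t ^ 2 / (truncMin A δ * truncMin A η)) ≤
      C * ((t / r) * max 1 (t / η)) ^ β * Φ (truncMin A r / truncMin A δ) := by
  have ht : 0 < t := hr.trans_le hrt
  have τr := truncMin_pos hA hr
  have τt := truncMin_pos hA ht
  have τδ := truncMin_pos hA hδ
  have τη := truncMin_pos hA hη
  have hk1 : 1 ≤ t / r := (one_le_div hr).2 hrt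
  have h1 : truncMin A t / truncMin A r ≤ t / r :=
    (truncMin_div_le hA hr).trans_eq (max_eq_right hk1)
  have h2 : truncMin A t / truncMin A η ≤ max 1 (t / η) := truncMin_div_le hA hη
  set v := truncMin A r / truncMin A δ with hv
  set k := (t / r) * max 1 (t / η) with hk
  have hv0 : 0 < v := by positivity
  have hk1' : 1 ≤ k := one_le_mul_of_one_le_of_one_le hk1 (le_max_left _ _)
  have harg : truncMin A t ^ 2 / (truncMin A δ * truncMin A η) ≤ k * v := by
    calc truncMin A t ^ 2 / (truncMin A δ * truncMin A η)
        = (truncMin A t / truncMin A r) * (truncMin A t / truncMin A η) * v := by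
          rw [hv]; field_simp
      _ ≤ k * v := by rw [hk]; gcongr
  refine (hΦmono (mem_Ici.2 (by positivity)) (mem_Ici.2 (by positivity)) harg).trans ?_
  have := hscale v (k * v) hv0 (le_mul_of_one_le_left hv0.le hk1')
  rwa [mul_div_cancel_right₀ _ hv0.ne'] at this

/-- Jumps of length comparable to `r` are at least as heavy as the weight at scale `r`. -/
lemma weight_le_comparable_jump (hC : 1 ≤ C) (hΦ1 : ∀ v, 0 ≤ v → 1 ≤ Φ v)
    (hΦmono : MonotoneOn Φ (Ici 0))
    (hscale : ∀ s r : ℝ, 0 < s → s ≤ r → Φ r ≤ C * (r / s) ^ β * Φ s) (hA : 0 < A)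
    {c : ℝ} (hc0 : 0 < c) (hc1 : c ≤ 1)
    (hr : 0 < r) (hrt : c * r ≤ t) (htr : t < r) (hδ : 0 < δ) (hη : 0 < η) (hηδ : η ≤ δ + t) :
    Φ (truncMin A r / truncMin A δ) ≤
      (Φ 1 + C * (2 / c ^ 2) ^ β) * Φ (truncMin A t ^ 2 / (truncMin A δ * truncMin A η)) := by
  have ht : 0 < t := (mul_pos hc0 hr).trans_le hrt
  have τr := truncMin_pos hA hr
  have τt := truncMin_pos hA ht
  have τδ := truncMin_pos hA hδ
  have τη := truncMin_pos hA hη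
  set w := truncMin A t ^ 2 / (truncMin A δ * truncMin A η) with hw
  have hw0 : 0 < w := by positivity
  have hw1 := hΦ1 w hw0.le
  have h11 := hΦ1 1 zero_le_one
  have hpow : 0 ≤ C * (2 / c ^ 2) ^ β := by positivity
  rcases le_or_gt r δ with h | h
  · have hle : truncMin A r / truncMin A δ ≤ 1 := (div_le_one τδ).2 (truncMin_mono h)
    have := hΦmono (mem_Ici.2 (by positivity)) (mem_Ici.2 zero_le_one) hle
    nlinarith
  have hη2 : truncMin A η ≤ 2 * truncMin A r :=
    (truncMin_mono (by linarith)).trans (truncMin_mul_le one_le_two)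
  have htr' : c * truncMin A r ≤ truncMin A t := by
    have h1 : truncMin A r ≤ truncMin A (c⁻¹ * t) :=
      truncMin_mono (by rwa [← div_eq_inv_mul, le_div_iff₀' hc0])
    have h2 := h1.trans (truncMin_mul_le ((one_le_inv₀ hc0).2 hc1))
    rwa [← div_eq_inv_mul, le_div_iff₀' hc0] at h2
  have hk1 : 1 ≤ 2 / c ^ 2 := by
    rw [one_le_div (by positivity)]
    nlinarith
  have harg : truncMin A r / truncMin A δ ≤ 2 / c ^ 2 * w := by
    rw [hw, div_mul_div_comm, div_le_div_iff₀ τδ (by positivity)]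
    have h3 : (c * truncMin A r) ^ 2 ≤ truncMin A t ^ 2 := by gcongr
    calc truncMin A r * (c ^ 2 * (truncMin A δ * truncMin A η))
        ≤ truncMin A r * (c ^ 2 * (truncMin A δ * (2 * truncMin A r))) := by gcongr
      _ = 2 * (c * truncMin A r) ^ 2 * truncMin A δ := by ring
      _ ≤ 2 * truncMin A t ^ 2 * truncMin A δ := by gcongr
  have h4 := hΦmono (mem_Ici.2 (by positivity)) (mem_Ici.2 (by positivity)) harg
  have h5 := hscale w (2 / c ^ 2 * w) hw0 (le_mul_of_one_le_left hw0.le hk1)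
  rw [mul_div_cancel_right₀ _ hw0.ne'] at h5
  nlinarith

lemma weight_le_max_div_rpow (hΦmono : MonotoneOn Φ (Ici 0))
    (hscale : ∀ s r : ℝ, 0 < s → s ≤ r → Φ r ≤ C * (r / s) ^ β * Φ s) (hA : 0 < A)
    (hr : 0 < r) (hδ : 0 < δ) :
    Φ (truncMin A r / truncMin A δ) ≤ C * Φ 1 * (max 1 (r / δ)) ^ β := by
  have τr := truncMin_pos hA hr
  have τδ := truncMin_pos hA hδ
  have h1 := hΦmono (mem_Ici.2 (by positivity)) (mem_Ici.2 (by positivity))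
    (truncMin_div_le (a := r) hA hδ)
  have h2 := hscale 1 (max 1 (r / δ)) one_pos (le_max_left _ _)
  rw [_root_.div_one] at h2
  linarith

end boundaryWeight

section truncation

variable {X : Type*} [MeasurableSpace X] {μ : Measure X} [SFinite μ] {j : X → X → ℝ≥0∞}
  {u : X → ℝ} {w : X → ℝ≥0∞} {N G : Set (X × X)} {m a K₁ K₂ K₃ c : ℝ≥0∞}

/-- The energy of long jumps is bounded by a weighted `L²` norm. -/
lemma lintegral_long_jumps_le (hj : Measurable (Function.uncurry j)) (hu : Measurable u)
    (hN : MeasurableSet N)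
    (hfst : ∀ᵐ x ∂μ, ∫⁻ y, Nᶜ.indicator (Function.uncurry j) (x, y) ∂μ ≤ K₁ * (a * w x))
    (hsnd : ∀ᵐ y ∂μ, ∫⁻ x, Nᶜ.indicator (Function.uncurry j) (x, y) ∂μ ≤ K₁ * (a * w y))
    (hw : Measurable w) :
    ∫⁻ p in Nᶜ, ENNReal.ofReal ((u p.1 - u p.2) ^ 2) * j p.1 p.2 ∂μ.prod μ ≤
      4 * K₁ * (a * ∫⁻ x, ENNReal.ofReal (u x ^ 2) * w x ∂μ) := by
  set U : X → ℝ≥0∞ := fun x => ENNReal.ofReal (u x ^ 2) with hU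
  have hUm : Measurable U := (hu.pow_const 2).ennreal_ofReal
  set k : X × X → ℝ≥0∞ := Nᶜ.indicator (Function.uncurry j) with hk
  have hkm : Measurable k := hj.indicator hN.compl
  have hUw : Measurable fun x => U x * w x := hUm.mul hw
  have hUk₁ : Measurable fun p : X × X => U p.1 * k p := (hUm.comp measurable_fst).mul hkm
  have hUk₂ : Measurable fun p : X × X => U p.2 * k p := (hUm.comp measurable_snd).mul hkm
  have hbd : ∀ f : X → ℝ≥0∞, (∀ᵐ x ∂μ, f x ≤ K₁ * (a * w x)) →
      ∫⁻ x, U x * f x ∂μ ≤ K₁ * (a * ∫⁻ x, U x * w x ∂μ) := by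
    intro f hf
    rw [← lintegral_const_mul _ hUw, ← lintegral_const_mul _ (hUw.const_mul _)]
    refine lintegral_mono_ae (hf.mono fun x hx => ?_)
    calc U x * f x ≤ U x * (K₁ * (a * w x)) := by gcongr
      _ = K₁ * (a * (U x * w x)) := by ring
  have h1 : ∫⁻ p, U p.1 * k p ∂μ.prod μ ≤ K₁ * (a * ∫⁻ x, U x * w x ∂μ) := by
    rw [lintegral_prod _ hUk₁.aemeasurable]
    refine le_trans (le_of_eq ?_) (hbd _ hfst)
    exact lintegral_congr fun x =>
      lintegral_const_mul (f := fun y => k (x, y)) (U x) (hkm.comp measurable_prodMk_left)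
  have h2 : ∫⁻ p, U p.2 * k p ∂μ.prod μ ≤ K₁ * (a * ∫⁻ x, U x * w x ∂μ) := by
    rw [lintegral_prod_symm _ hUk₂.aemeasurable]
    refine le_trans (le_of_eq ?_) (hbd _ hsnd)
    exact lintegral_congr fun y =>
      lintegral_const_mul (f := fun x => k (x, y)) (U y) (hkm.comp measurable_prodMk_right)
  have hpt : ∀ p : X × X, Nᶜ.indicator
      (fun p => ENNReal.ofReal ((u p.1 - u p.2) ^ 2) * j p.1 p.2) p ≤
        2 * (U p.1 * k p + U p.2 * k p) := by
    intro p
    by_cases hp : p ∈ Nᶜ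
    · rw [hk, indicator_of_mem hp, indicator_of_mem hp, ← add_mul, ← mul_assoc]
      refine mul_le_mul_left ?_ _
      rw [hU, ← ENNReal.ofReal_add (by positivity) (by positivity), ← ENNReal.ofReal_ofNat,
        ← ENNReal.ofReal_mul (by norm_num)]
      exact ENNReal.ofReal_le_ofReal (by nlinarith [sq_nonneg (u p.1 + u p.2)])
    · rw [indicator_of_notMem hp]
      exact zero_le
  rw [← lintegral_indicator hN.compl]
  calc _ ≤ ∫⁻ p, 2 * (U p.1 * k p + U p.2 * k p) ∂μ.prod μ := lintegral_mono hpt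
    _ = 2 * (∫⁻ p, U p.1 * k p ∂μ.prod μ + ∫⁻ p, U p.2 * k p ∂μ.prod μ) := by
      rw [lintegral_const_mul, lintegral_add_left hUk₁]
      fun_prop
    _ ≤ 2 * (K₁ * (a * ∫⁻ x, U x * w x ∂μ) + K₁ * (a * ∫⁻ x, U x * w x ∂μ)) := by gcongr
    _ = _ := by ring

/-- A weighted `L²` norm is bounded by the energy of short jumps and the plain `L²` norm. -/
lemma weighted_lintegral_le_short_jumps (hj : Measurable (Function.uncurry j))
    (hu : Measurable u) (hw : Measurable w) (hN : MeasurableSet N) (hG : MeasurableSet G) (hGN : G ⊆ N)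
    (hm0 : m ≠ 0) (hm : m ≠ ∞) (hc0 : c ≠ 0) (hc : c ≠ ∞)
    (hcomp : ∀ᵐ p ∂μ.prod μ, p ∈ G → a * w p.1 ≤ K₂ * (m * j p.1 p.2))
    (hvol : ∀ᵐ x ∂μ, c * m ≤ μ (Prod.mk x ⁻¹' G))
    (hint : ∀ᵐ y ∂μ, ∫⁻ x, G.indicator (fun p => w p.1) (x, y) ∂μ ≤ K₃ * m) :
    a * ∫⁻ x, ENNReal.ofReal (u x ^ 2) * w x ∂μ ≤
      2 * c⁻¹ * (K₂ * ∫⁻ p in N, ENNReal.ofReal ((u p.1 - u p.2) ^ 2) * j p.1 p.2 ∂μ.prod μ +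
        K₃ * (a * ∫⁻ x, ENNReal.ofReal (u x ^ 2) ∂μ)) := by
  set U : X → ℝ≥0∞ := fun x => ENNReal.ofReal (u x ^ 2) with hU
  have hUm : Measurable U := (hu.pow_const 2).ennreal_ofReal
  set V : X × X → ℝ≥0∞ := fun p => ENNReal.ofReal ((u p.1 - u p.2) ^ 2) * j p.1 p.2 with hV
  have hVm : Measurable V :=
    (((hu.comp measurable_fst).sub (hu.comp measurable_snd)).pow_const 2).ennreal_ofReal.mul hj
  set k : X × X → ℝ≥0∞ := G.indicator (fun p => w p.1) with hk
  have hkm : Measurable k := (hw.comp measurable_fst).indicator hG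
  have hUw : Measurable fun x => U x * w x := hUm.mul hw
  have haUw : Measurable fun p : X × X => a * (U p.1 * w p.1) :=
    (hUw.comp measurable_fst).const_mul a
  have hUk : Measurable fun p : X × X => U p.2 * k p := (hUm.comp measurable_snd).mul hkm
  have hlow : c * m * (a * ∫⁻ x, U x * w x ∂μ) ≤
      ∫⁻ p, G.indicator (fun p => a * (U p.1 * w p.1)) p ∂μ.prod μ := by
    rw [lintegral_prod _ (haUw.indicator hG).aemeasurable,
      ← lintegral_const_mul _ hUw,
      ← lintegral_const_mul _ (hUw.const_mul _)]
    refine lintegral_mono_ae (hvol.mono fun x hx => ?_)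
    calc c * m * (a * (U x * w x)) ≤ a * (U x * w x) * μ (Prod.mk x ⁻¹' G) := by
          rw [mul_comm]; gcongr
      _ = ∫⁻ y, (Prod.mk x ⁻¹' G).indicator (fun _ => a * (U x * w x)) y ∂μ := by
          rw [lintegral_indicator_const (measurable_prodMk_left hG)]
  have hup : ∀ᵐ p ∂μ.prod μ, G.indicator (fun p => a * (U p.1 * w p.1)) p ≤
      2 * (K₂ * (m * N.indicator V p) + a * (U p.2 * k p)) := by
    filter_upwards [hcomp] with p hp
    by_cases hpG : p ∈ G
    · rw [hk, indicator_of_mem hpG, indicator_of_mem hpG, indicator_of_mem (hGN hpG)]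
      have h1 : U p.1 ≤ 2 * (ENNReal.ofReal ((u p.1 - u p.2) ^ 2) + U p.2) := by
        rw [hU, ← ENNReal.ofReal_add (by positivity) (by positivity), ← ENNReal.ofReal_ofNat,
          ← ENNReal.ofReal_mul (by norm_num)]
        exact ENNReal.ofReal_le_ofReal (by nlinarith [sq_nonneg (u p.1 - 2 * u p.2)])
      calc a * (U p.1 * w p.1)
          ≤ a * (2 * (ENNReal.ofReal ((u p.1 - u p.2) ^ 2) + U p.2) * w p.1) := by gcongr
        _ = 2 * (ENNReal.ofReal ((u p.1 - u p.2) ^ 2) * (a * w p.1) + a * (U p.2 * w p.1)) := by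
          ring
        _ ≤ 2 * (ENNReal.ofReal ((u p.1 - u p.2) ^ 2) * (K₂ * (m * j p.1 p.2)) +
              a * (U p.2 * w p.1)) := by gcongr _ * (_ * ?_ + _); exact hp hpG
        _ = _ := by rw [hV]; ring
    · rw [indicator_of_notMem hpG]
      exact zero_le
  have hsnd : ∫⁻ p, U p.2 * k p ∂μ.prod μ ≤ K₃ * m * ∫⁻ x, U x ∂μ := by
    rw [lintegral_prod_symm _ hUk.aemeasurable,
      ← lintegral_const_mul _ hUm]
    refine lintegral_mono_ae (hint.mono fun y hy => ?_)
    calc _ = U y * ∫⁻ x, k (x, y) ∂μ :=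
          lintegral_const_mul _ (hkm.comp measurable_prodMk_right)
      _ ≤ U y * (K₃ * m) := by gcongr
      _ = _ := mul_comm _ _
  have hmV : Measurable (N.indicator V) := hVm.indicator hN
  have hNV : ∫⁻ p, N.indicator V p ∂μ.prod μ ≤ ∫⁻ p in N, V p ∂μ.prod μ :=
    lintegral_indicator_le _ _
  have key : c * m * (a * ∫⁻ x, U x * w x ∂μ) ≤
      c * m * (2 * c⁻¹ * (K₂ * ∫⁻ p in N, V p ∂μ.prod μ + K₃ * (a * ∫⁻ x, U x ∂μ))) := by
    calc _ ≤ ∫⁻ p, 2 * (K₂ * (m * N.indicator V p) + a * (U p.2 * k p)) ∂μ.prod μ :=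
          hlow.trans (lintegral_mono_ae hup)
      _ = 2 * (K₂ * (m * ∫⁻ p, N.indicator V p ∂μ.prod μ) +
            a * ∫⁻ p, U p.2 * k p ∂μ.prod μ) := by
          rw [lintegral_const_mul, lintegral_add_left, lintegral_const_mul _ hUk,
            lintegral_const_mul, lintegral_const_mul _ hmV]
          all_goals fun_prop
      _ ≤ 2 * (K₂ * (m * ∫⁻ p in N, V p ∂μ.prod μ) + a * (K₃ * m * ∫⁻ x, U x ∂μ)) := by gcongr
      _ = (c * c⁻¹) * (2 * (K₂ * (m * ∫⁻ p in N, V p ∂μ.prod μ) +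
            a * (K₃ * m * ∫⁻ x, U x ∂μ))) := by
          rw [ENNReal.mul_inv_cancel hc0 hc, _root_.one_mul]
      _ = _ := by ring
  exact (ENNReal.mul_le_mul_iff_right (mul_ne_zero hc0 hm0) (ENNReal.mul_ne_top hc hm)).1 key

end truncation

/-- Tail integrals of the jump kernel at scale `r`, by summing over dyadic annuli. -/
lemma lintegral_tail_le {d : ℕ} {δ : EuclideanSpace ℝ (Fin d) → ℝ} (hδ : ∀ y, 0 ≤ δ y)
    {α β K : ℝ} (hβ : 0 ≤ β) (hβα : β < α) (hK : 0 ≤ K)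
    (hball : ∀ (x : EuclideanSpace ℝ (Fin d)) (s : ℝ), 0 < s →
      ∫⁻ y in ball x s, ENNReal.ofReal ((max 1 (s / δ y)) ^ β) ≤ ENNReal.ofReal (K * s ^ d))
    (x : EuclideanSpace ℝ (Fin d)) {r : ℝ} (hr : 0 < r) :
    ∫⁻ y in {y | r ≤ dist x y}, ENNReal.ofReal
        (dist x y ^ (-((d : ℝ) + α)) * ((dist x y / r) * max 1 (dist x y / δ y)) ^ β) ≤
      ENNReal.ofReal (K * 2 ^ d * 2 ^ β / (1 - 2 ^ (β - α)) * r ^ (-α)) := by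
  set q : ℝ := 2 ^ (β - α) with hq
  have hq0 : 0 < q := by positivity
  have hq1 : q < 1 := Real.rpow_lt_one_of_one_lt_of_neg (by norm_num) (by linarith)
  set A : ℕ → Set (EuclideanSpace ℝ (Fin d)) :=
    fun n => {y | 2 ^ n * r ≤ dist x y} ∩ ball x (2 ^ (n + 1) * r) with hA
  have hAmeas : ∀ n, MeasurableSet (A n) := fun n =>
    (measurableSet_le measurable_const (by fun_prop)).inter measurableSet_ball
  have hcover : {y | r ≤ dist x y} ⊆ ⋃ n, A n := by
    intro y (hy : r ≤ dist x y)
    obtain ⟨n, hn1, hn2⟩ := exists_nat_pow_near ((one_le_div hr).2 hy) (one_lt_two : (1 : ℝ) < 2)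
    rw [le_div_iff₀ hr] at hn1
    rw [div_lt_iff₀ hr] at hn2
    exact mem_iUnion.2 ⟨n, hn1, by rwa [mem_ball, dist_comm]⟩
  have hterm : ∀ n : ℕ, ∫⁻ y in A n, ENNReal.ofReal
        (dist x y ^ (-((d : ℝ) + α)) * ((dist x y / r) * max 1 (dist x y / δ y)) ^ β) ≤
      ENNReal.ofReal (K * 2 ^ d * 2 ^ β * r ^ (-α) * q ^ n) := by
    intro n
    have hsr : 0 < 2 ^ n * r := by positivity
    set M : ℝ := (2 ^ n * r) ^ (-((d : ℝ) + α)) * (2 ^ (n + 1)) ^ β with hM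
    have hM0 : 0 ≤ M := by positivity
    have hd0 : (0 : ℝ) ≤ d := by positivity
    calc _ ≤ ∫⁻ y in A n, ENNReal.ofReal M *
          ENNReal.ofReal ((max 1 (2 ^ (n + 1) * r / δ y)) ^ β) := by
          refine setLIntegral_mono' (hAmeas n) fun y hy => ?_
          have hy1 : 2 ^ n * r ≤ dist x y := hy.1
          have hy2 : dist x y ≤ 2 ^ (n + 1) * r := by
            have := hy.2
            rw [mem_ball, dist_comm] at this
            exact this.le
          rw [← ENNReal.ofReal_mul hM0]
          refine ENNReal.ofReal_le_ofReal ?_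
          have hδy := hδ y
          have h1 : dist x y ^ (-((d : ℝ) + α)) ≤ (2 ^ n * r) ^ (-((d : ℝ) + α)) :=
            Real.rpow_le_rpow_of_nonpos hsr hy1 (by linarith)
          have h2 : dist x y / r * max 1 (dist x y / δ y) ≤
              2 ^ (n + 1) * max 1 (2 ^ (n + 1) * r / δ y) := by
            gcongr
            rwa [div_le_iff₀ hr]
          calc _ ≤ (2 ^ n * r) ^ (-((d : ℝ) + α)) *
                (2 ^ (n + 1) * max 1 (2 ^ (n + 1) * r / δ y)) ^ β := by gcongr
            _ = _ := by
              rw [Real.mul_rpow (x := 2 ^ (n + 1)) (by positivity) (by positivity), hM]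
              ring
      _ ≤ ENNReal.ofReal M *
          ∫⁻ y in ball x (2 ^ (n + 1) * r),
            ENNReal.ofReal ((max 1 (2 ^ (n + 1) * r / δ y)) ^ β) := by
          rw [lintegral_const_mul' _ _ ofReal_ne_top]
          gcongr
          exact inter_subset_right
      _ ≤ ENNReal.ofReal M * ENNReal.ofReal (K * (2 ^ (n + 1) * r) ^ d) := by
          gcongr
          exact hball x _ (by positivity)
      _ = _ := by
          rw [← ENNReal.ofReal_mul hM0]
          congr 1
          have hqn : q ^ n = (2 ^ n : ℝ) ^ β * ((2 ^ n : ℝ) ^ α)⁻¹ := by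
            rw [hq, Real.rpow_sub (by norm_num), div_pow, Real.rpow_pow_comm (by norm_num),
              Real.rpow_pow_comm (by norm_num), div_eq_mul_inv]
          rw [hM, hqn, neg_add, Real.rpow_add hsr, Real.rpow_neg hsr.le, Real.rpow_neg hsr.le,
            Real.rpow_natCast, Real.mul_rpow (by positivity) hr.le, Real.rpow_neg hr.le, pow_succ,
            Real.mul_rpow (by positivity) (by norm_num)]
          have h2 : (2 : ℝ) ^ n * 2 * r = 2 * (2 ^ n * r) := by ring
          rw [h2, mul_pow 2 (2 ^ n * r) d]
          field_simp
  calc _ ≤ ∫⁻ y in ⋃ n, A n, ENNReal.ofReal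
        (dist x y ^ (-((d : ℝ) + α)) * ((dist x y / r) * max 1 (dist x y / δ y)) ^ β) :=
        lintegral_mono_set hcover
    _ ≤ ∑' n : ℕ, ENNReal.ofReal (K * 2 ^ d * 2 ^ β * r ^ (-α) * q ^ n) :=
        (lintegral_iUnion_le _ _).trans (ENNReal.tsum_le_tsum hterm)
    _ = _ := by
        rw [tsum_ofReal_geometric (by positivity) hq0.le hq1]
        congr 1
        ring

/-- The part of a fat set in an annulus around one of its points has comparable volume. -/
lemma le_volume_annulus_of_ball_subset {d : ℕ} (hd : 1 ≤ d) {D : Set (EuclideanSpace ℝ (Fin d))}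
    {κ r : ℝ} (hκ : 0 < κ) (hr : 0 < r) {x z : EuclideanSpace ℝ (Fin d)}
    (hz : ball z (κ * r) ⊆ D ∩ ball x r) :
    ENNReal.ofReal (κ ^ d / 2 * (volume (ball (0 : EuclideanSpace ℝ (Fin d)) 1)).toReal) *
        ENNReal.ofReal (r ^ d) ≤
      volume (D ∩ {y | κ / 2 * r ≤ dist x y ∧ dist x y < r}) := by
  set ω : ℝ := (volume (ball (0 : EuclideanSpace ℝ (Fin d)) 1)).toReal with hω
  have hsub : ball z (κ * r) \ ball x (κ / 2 * r) ⊆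
      D ∩ {y | κ / 2 * r ≤ dist x y ∧ dist x y < r} := by
    rintro y ⟨hy, hyx⟩
    rw [mem_ball, dist_comm, not_lt] at hyx
    refine ⟨(hz hy).1, hyx, ?_⟩
    rw [dist_comm]
    exact (hz hy).2
  refine le_trans ?_ (measure_mono hsub)
  refine le_trans ?_ le_measure_sdiff
  rw [volume_ball_eq_ofReal z (by positivity), volume_ball_eq_ofReal x (by positivity),
    ← ENNReal.ofReal_sub _ (by positivity), ← ENNReal.ofReal_mul (by positivity)]
  refine ENNReal.ofReal_le_ofReal ?_
  have h2 : ((1 : ℝ) / 2) ^ d ≤ 1 / 2 := by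
    simpa using pow_le_pow_of_le_one (by norm_num : (0 : ℝ) ≤ 1 / 2) (by norm_num) hd
  have h3 : κ / 2 * r = (1 / 2) * (κ * r) := by ring
  have h4 : 0 ≤ (κ * r) ^ d * ω := by positivity
  rw [h3, mul_pow (1 / 2), mul_pow] at *
  nlinarith

/-- The truncation estimate at any scale at which the set is fat. -/
lemma exists_truncation_bound {d : ℕ} (hd : 1 ≤ d) {D : Set (EuclideanSpace ℝ (Fin d))}
    (hDopen : IsOpen D) (hfr : (frontier D).Nonempty)
    {κ : ℝ} (hκ0 : 0 < κ) (hκ1 : κ < 1) {R₀ : ℝ≥0∞}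
    (hfat : ∀ x ∈ closure D, ∀ r : ℝ, 0 < r → ENNReal.ofReal r < R₀ →
      ∃ z ∈ D, ball z (κ * r) ⊆ D ∩ ball x r)
    {Φ : ℝ → ℝ} {β C_Φ : ℝ} (hβ : 0 ≤ β) (hC_Φ : 1 ≤ C_Φ)
    (hΦ1 : ∀ r : ℝ, 0 ≤ r → 1 ≤ Φ r)
    (hΦmono : MonotoneOn Φ (Ici 0)) (hΦcont : ContinuousOn Φ (Ici 0))
    (hΦscale : ∀ s r : ℝ, 0 < s → s ≤ r → Φ r ≤ C_Φ * (r / s) ^ β * Φ s)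
    {α : ℝ} (hβα : β < α) {A₀ : ℝ≥0∞} (hA₀ : 0 < A₀)
    {J : EuclideanSpace ℝ (Fin d) → EuclideanSpace ℝ (Fin d) → ℝ}
    {C₁ : ℝ} (hC₁ : 1 < C₁)
    (hJmeas : Measurable (Function.uncurry J))
    (hJsym : ∀ x ∈ D, ∀ y ∈ D, J x y = J y x)
    (hJbound : ∀ x ∈ D, ∀ y ∈ D, x ≠ y →
      C₁⁻¹ * (dist x y ^ (-((d : ℝ) + α)) *
          Φ ((truncMin A₀ (dist x y)) ^ 2 /
            (truncMin A₀ (deltaD D x) * truncMin A₀ (deltaD D y)))) ≤ J x y ∧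
      J x y ≤ C₁ * (dist x y ^ (-((d : ℝ) + α)) *
          Φ ((truncMin A₀ (dist x y)) ^ 2 /
            (truncMin A₀ (deltaD D x) * truncMin A₀ (deltaD D y)))))
    {lam : ℝ} (hCov : CoveringCond D lam) (hβlam : β < (d : ℝ) - lam) :
    ∃ C : ℝ, 0 < C ∧ ∀ r : ℝ, 0 < r → ENNReal.ofReal r < R₀ →
      ∀ u : EuclideanSpace ℝ (Fin d) → ℝ, Measurable u →
      (∫⁻ p in D ×ˢ D, ENNReal.ofReal ((u p.1 - u p.2) ^ 2 * J p.1 p.2)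
          ∂(volume.prod volume)) ≤
        ENNReal.ofReal C *
          ((∫⁻ p in (D ×ˢ D) ∩ {p : EuclideanSpace ℝ (Fin d) × EuclideanSpace ℝ (Fin d) |
                dist p.1 p.2 < r},
              ENNReal.ofReal ((u p.1 - u p.2) ^ 2 * J p.1 p.2) ∂(volume.prod volume)) +
            ENNReal.ofReal (r ^ (-α)) * ∫⁻ x in D, ENNReal.ofReal (u x ^ 2)) := by
  obtain ⟨K, hK, hball⟩ := lintegral_ball_max_div_infDist_le hfr hCov hβ hβlam
  have hδpos : ∀ x ∈ D, 0 < deltaD D x := by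
    intro x hx
    refine (isClosed_frontier.notMem_iff_infDist_pos hfr).1 fun hxf => ?_
    rw [hDopen.frontier_eq] at hxf
    exact hxf.2 hx
  have hδmeas : Measurable (deltaD D) := (continuous_infDist_pt _).measurable
  have hΦ11 := hΦ1 1 zero_le_one
  have hq1 : (2 : ℝ) ^ (β - α) < 1 :=
    Real.rpow_lt_one_of_one_lt_of_neg (by norm_num) (by linarith)
  have hT : 0 ≤ K * 2 ^ d * 2 ^ β / (1 - 2 ^ (β - α)) :=
    div_nonneg (by positivity) (by linarith)
  set T : ℝ := K * 2 ^ d * 2 ^ β / (1 - 2 ^ (β - α)) with hTdef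
  set ω : ℝ := (volume (ball (0 : EuclideanSpace ℝ (Fin d)) 1)).toReal with hω
  have hω0 : 0 < ω := ENNReal.toReal_pos (measure_ball_pos _ _ one_pos).ne' measure_ball_lt_top.ne
  set K₁ : ℝ≥0∞ := ENNReal.ofReal (C₁ * C_Φ * T) with hK₁
  set K₂' : ℝ := Φ 1 + C_Φ * (2 / (κ / 2) ^ 2) ^ β with hK₂'
  have hK₂'0 : 0 ≤ K₂' := by positivity
  set K₂ : ℝ≥0∞ := ENNReal.ofReal (K₂' * C₁) with hK₂
  set K₃ : ℝ≥0∞ := ENNReal.ofReal (C_Φ * Φ 1 * K) with hK₃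
  set c : ℝ≥0∞ := ENNReal.ofReal (κ ^ d / 2 * ω) with hc
  have hc0 : c ≠ 0 := (ENNReal.ofReal_pos.2 (by positivity)).ne'
  set C : ℝ≥0∞ := 1 + 4 * K₁ * (2 * c⁻¹ * (K₂ + K₃)) with hC
  have hCtop : C ≠ ∞ := by
    have : c⁻¹ ≠ ∞ := ENNReal.inv_ne_top.2 hc0
    finiteness
  have hC0 : C ≠ 0 := by simp [hC]
  refine ⟨C.toReal, ENNReal.toReal_pos hC0 hCtop, fun r hr hrR u hu => ?_⟩
  rw [ENNReal.ofReal_toReal hCtop]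
  set j : EuclideanSpace ℝ (Fin d) → EuclideanSpace ℝ (Fin d) → ℝ≥0∞ :=
    fun x y => ENNReal.ofReal (J x y) with hj
  have hjm : Measurable (Function.uncurry j) := hJmeas.ennreal_ofReal
  set W : EuclideanSpace ℝ (Fin d) → ℝ :=
    fun x => Φ (truncMin A₀ r / truncMin A₀ (deltaD D x)) with hW
  have hτ0 : ∀ a, 0 ≤ truncMin A₀ a := fun a => ENNReal.toReal_nonneg
  have hW0 : ∀ x, 0 ≤ W x := fun x => zero_le_one.trans (hΦ1 _ (div_nonneg (hτ0 _) (hτ0 _)))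
  have hWm : Measurable W := by
    have h1 : Continuous fun v => Φ (max v 0) :=
      hΦcont.comp_continuous (continuous_id.max continuous_const) fun v => mem_Ici.2 (le_max_right _ _)
    have h2 : Measurable fun x => truncMin A₀ r / truncMin A₀ (deltaD D x) :=
      (continuous_truncMin.measurable.comp hδmeas).const_div _
    have h3 : W = (fun v => Φ (max v 0)) ∘ fun x => truncMin A₀ r / truncMin A₀ (deltaD D x) := by
      funext x
      simp only [Function.comp, hW]
      rw [max_eq_left (div_nonneg (hτ0 _) (hτ0 _))]
    rw [h3]
    exact h1.measurable.comp h2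
  set w : EuclideanSpace ℝ (Fin d) → ℝ≥0∞ := fun x => ENNReal.ofReal (W x) with hw
  have hwm : Measurable w := hWm.ennreal_ofReal
  set a : ℝ≥0∞ := ENNReal.ofReal (r ^ (-α)) with ha
  set m : ℝ≥0∞ := ENNReal.ofReal (r ^ d) with hm
  have hm0 : m ≠ 0 := (ENNReal.ofReal_pos.2 (by positivity)).ne'
  set N : Set (EuclideanSpace ℝ (Fin d) × EuclideanSpace ℝ (Fin d)) :=
    {p | dist p.1 p.2 < r} with hN
  have hNm : MeasurableSet N := measurableSet_lt (by fun_prop) measurable_const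
  set G : Set (EuclideanSpace ℝ (Fin d) × EuclideanSpace ℝ (Fin d)) :=
    {p | κ / 2 * r ≤ dist p.1 p.2 ∧ dist p.1 p.2 < r} with hG
  have hGm : MeasurableSet G :=
    (measurableSet_le (f := fun _ => κ / 2 * r)
      (g := fun p : EuclideanSpace ℝ (Fin d) × EuclideanSpace ℝ (Fin d) => dist p.1 p.2)
      measurable_const (by fun_prop)).inter hNm
  set μ : Measure (EuclideanSpace ℝ (Fin d)) := volume.restrict D with hμ
  have hDm : MeasurableSet D := hDopen.measurableSet
  have hμμ : μ.prod μ = (volume.prod volume).restrict (D ×ˢ D) := Measure.prod_restrict _ _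
  have hfst' : ∀ x ∈ D, ∫⁻ y in D, Nᶜ.indicator (Function.uncurry j) (x, y) ≤ K₁ * (a * w x) := by
    intro x hx
    set k : EuclideanSpace ℝ (Fin d) → ℝ≥0∞ := fun y => ENNReal.ofReal
      (dist x y ^ (-((d : ℝ) + α)) * ((dist x y / r) * max 1 (dist x y / deltaD D y)) ^ β) with hk
    have hSm : MeasurableSet {y | r ≤ dist x y} := measurableSet_le measurable_const (by fun_prop)
    calc _ ≤ ∫⁻ y in D, {y | r ≤ dist x y}.indicator
          (fun y => ENNReal.ofReal (C₁ * C_Φ * W x) * k y) y := by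
          refine setLIntegral_mono' hDm fun y hy => ?_
          by_cases hxy : r ≤ dist x y
          · have hxyN : (x, y) ∈ Nᶜ := not_lt.2 hxy
            rw [indicator_of_mem hxyN, indicator_of_mem (by exact hxy), hk,
              ← ENNReal.ofReal_mul (by have := hW0 x; positivity)]
            refine ENNReal.ofReal_le_ofReal ?_
            refine (hJbound x hx y hy (dist_pos.1 (hr.trans_le hxy))).2.trans ?_
            have := weight_long_jump_le hΦmono hΦscale hA₀ hr hxy (hδpos x hx) (hδpos y hy)
            calc _ ≤ C₁ * (dist x y ^ (-((d : ℝ) + α)) *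
                  (C_Φ * ((dist x y / r) * max 1 (dist x y / deltaD D y)) ^ β * W x)) := by
                  gcongr
              _ = _ := by ring
          · have hxyN : (x, y) ∉ Nᶜ := fun h => hxy (not_lt.1 h)
            rw [indicator_of_notMem hxyN]
            exact zero_le
      _ ≤ ∫⁻ y in {y | r ≤ dist x y}, ENNReal.ofReal (C₁ * C_Φ * W x) * k y := by
          rw [← lintegral_indicator hSm]
          exact setLIntegral_le_lintegral _ _
      _ = ENNReal.ofReal (C₁ * C_Φ * W x) * ∫⁻ y in {y | r ≤ dist x y}, k y :=
          lintegral_const_mul' _ _ ofReal_ne_top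
      _ ≤ ENNReal.ofReal (C₁ * C_Φ * W x) * ENNReal.ofReal (T * r ^ (-α)) := by
          gcongr
          exact lintegral_tail_le (fun y => infDist_nonneg) hβ hβα hK hball x hr
      _ = K₁ * (a * w x) := by
          have hWx := hW0 x
          rw [hK₁, ha, hw, ← ENNReal.ofReal_mul (by positivity), ← ENNReal.ofReal_mul (by positivity),
            ← ENNReal.ofReal_mul (by positivity)]
          congr 1
          ring
  have hfst : ∀ᵐ x ∂μ, ∫⁻ y, Nᶜ.indicator (Function.uncurry j) (x, y) ∂μ ≤ K₁ * (a * w x) :=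
    (ae_restrict_mem hDm).mono hfst'
  have hsnd : ∀ᵐ y ∂μ, ∫⁻ x, Nᶜ.indicator (Function.uncurry j) (x, y) ∂μ ≤ K₁ * (a * w y) := by
    refine (ae_restrict_mem hDm).mono fun y hy => le_trans (le_of_eq ?_) (hfst' y hy)
    refine setLIntegral_congr_fun hDm fun x hx => ?_
    have hiff : (x, y) ∈ Nᶜ ↔ (y, x) ∈ Nᶜ := by simp [hN, dist_comm]
    by_cases h : (x, y) ∈ Nᶜ
    · simp only [indicator_of_mem h, indicator_of_mem (hiff.1 h), Function.uncurry, hj]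
      rw [hJsym x hx y hy]
    · rw [indicator_of_notMem h, indicator_of_notMem (mt hiff.2 h)]
  have hcomp : ∀ᵐ p ∂μ.prod μ, p ∈ G → a * w p.1 ≤ K₂ * (m * j p.1 p.2) := by
    rw [hμμ]
    refine (ae_restrict_mem (hDm.prod hDm)).mono ?_
    rintro ⟨x, y⟩ ⟨hx, hy⟩ ⟨hκt, htr⟩
    simp only at hx hy hκt htr ⊢
    have ht : 0 < dist x y := (by positivity : 0 < κ / 2 * r).trans_le hκt
    have hlow := (hJbound x hx y hy (dist_pos.1 ht)).1
    have hδ : deltaD D y ≤ deltaD D x + dist x y := by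
      rw [dist_comm]
      exact infDist_le_infDist_add_dist
    have hwt := weight_le_comparable_jump hC_Φ hΦ1 hΦmono hΦscale hA₀ (by positivity)
      (by linarith : κ / 2 ≤ 1) hr hκt htr (hδpos x hx) (hδpos y hy) hδ
    set F := Φ ((truncMin A₀ (dist x y)) ^ 2 /
            (truncMin A₀ (deltaD D x) * truncMin A₀ (deltaD D y))) with hF
    have hF0 : 0 ≤ F := zero_le_one.trans
      (hΦ1 _ (div_nonneg (sq_nonneg _) (mul_nonneg (hτ0 _) (hτ0 _))))
    rw [ha, hw, hK₂, hm, hj, ← ENNReal.ofReal_mul (by positivity),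
      ← ENNReal.ofReal_mul (by positivity), ← ENNReal.ofReal_mul (by positivity)]
    refine ENNReal.ofReal_le_ofReal ?_
    have hαpos : 0 ≤ α := by linarith
    have hpow : r ^ (-((d : ℝ) + α)) ≤ dist x y ^ (-((d : ℝ) + α)) :=
      Real.rpow_le_rpow_of_nonpos ht htr.le (neg_nonpos.2 (by positivity))
    have hJ' : dist x y ^ (-((d : ℝ) + α)) * F ≤ C₁ * J x y := by
      rwa [inv_mul_le_iff₀ (by linarith)] at hlow
    calc r ^ (-α) * W x ≤ r ^ (-α) * (K₂' * F) := by gcongr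
      _ = K₂' * r ^ d * (r ^ (-((d : ℝ) + α)) * F) := by
        rw [neg_add, Real.rpow_add hr, Real.rpow_neg hr.le (d : ℝ), Real.rpow_natCast]
        field_simp
      _ ≤ K₂' * r ^ d * (dist x y ^ (-((d : ℝ) + α)) * F) := by gcongr
      _ ≤ K₂' * r ^ d * (C₁ * J x y) := by gcongr
      _ = _ := by ring
  have hvol : ∀ᵐ x ∂μ, c * m ≤ μ (Prod.mk x ⁻¹' G) := by
    refine (ae_restrict_mem hDm).mono fun x hx => ?_
    obtain ⟨z, -, hz⟩ := hfat x (subset_closure hx) r hr hrR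
    rw [hμ, Measure.restrict_apply (measurable_prodMk_left hGm), inter_comm]
    exact le_volume_annulus_of_ball_subset hd hκ0 hr hz
  have hint : ∀ᵐ y ∂μ, ∫⁻ x, G.indicator (fun p => w p.1) (x, y) ∂μ ≤ K₃ * m := by
    refine Eventually.of_forall fun y => ?_
    calc _ ≤ ∫⁻ x in D, (ball y r).indicator (fun x => ENNReal.ofReal (C_Φ * Φ 1) *
          ENNReal.ofReal ((max 1 (r / deltaD D x)) ^ β)) x := by
          refine setLIntegral_mono' hDm fun x hx => ?_
          by_cases h : (x, y) ∈ G
          · have hxy : x ∈ ball y r := h.2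
            rw [indicator_of_mem h, indicator_of_mem hxy, ← ENNReal.ofReal_mul (by positivity)]
            exact ENNReal.ofReal_le_ofReal
              (weight_le_max_div_rpow hΦmono hΦscale hA₀ hr (hδpos x hx))
          · rw [indicator_of_notMem h]
            exact zero_le
      _ ≤ ENNReal.ofReal (C_Φ * Φ 1) *
            ∫⁻ x in ball y r, ENNReal.ofReal ((max 1 (r / deltaD D x)) ^ β) := by
          rw [← lintegral_const_mul' _ _ ofReal_ne_top, ← lintegral_indicator measurableSet_ball]
          exact setLIntegral_le_lintegral _ _
      _ ≤ ENNReal.ofReal (C_Φ * Φ 1) * ENNReal.ofReal (K * r ^ d) := by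
          gcongr
          exact hball y r hr
      _ = K₃ * m := by
          rw [hK₃, hm, ← ENNReal.ofReal_mul (by positivity), ← ENNReal.ofReal_mul (by positivity)]
          congr 1
          ring
  have hlong := lintegral_long_jumps_le hjm hu hNm hfst hsnd hwm
  have hshort := weighted_lintegral_le_short_jumps hjm hu hwm hNm hGm (fun p hp => hp.2) hm0
    ofReal_ne_top hc0 ofReal_ne_top hcomp hvol hint
  simp only [ENNReal.ofReal_mul (sq_nonneg _)]
  rw [inter_comm, ← Measure.restrict_restrict hNm, ← hμμ, ← lintegral_add_compl _ hNm]
  set I := ∫⁻ p in N, ENNReal.ofReal ((u p.1 - u p.2) ^ 2) * j p.1 p.2 ∂μ.prod μ with hI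
  set L := a * ∫⁻ x, ENNReal.ofReal (u x ^ 2) ∂μ with hL
  calc _ ≤ I + 4 * K₁ * (2 * c⁻¹ * (K₂ * I + K₃ * L)) := by
        gcongr
        exact hlong.trans (by gcongr)
    _ ≤ (I + L) + 4 * K₁ * (2 * c⁻¹ * (K₂ * (I + L) + K₃ * (I + L))) := by
        gcongr
        · exact le_self_add
        · exact le_self_add
        · exact le_add_self
    _ = C * (I + L) := by rw [hC]; ring

theorem stmt12 {d : ℕ} (hd : 1 ≤ d) (D : Set (EuclideanSpace ℝ (Fin d)))
    (hDopen : IsOpen D) (hDne : D.Nonempty) (hfr : (frontier D).Nonempty)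
    (κ : ℝ) (hκ0 : 0 < κ) (hκ1 : κ < 1) (R₀ : ℝ≥0∞) (hR₀0 : 0 < R₀)
    (hR₀diam : R₀ ≤ EMetric.diam D)
    (hfat : ∀ x ∈ closure D, ∀ r : ℝ, 0 < r → ENNReal.ofReal r < R₀ →
      ∃ z ∈ D, Metric.ball z (κ * r) ⊆ D ∩ Metric.ball x r)
    (Φ : ℝ → ℝ) (β₁ C_Φ : ℝ) (hβ₁ : 0 ≤ β₁) (hC_Φ : 1 ≤ C_Φ)
    (hΦ0 : Φ 0 = 1) (hΦ1 : ∀ r : ℝ, 0 ≤ r → 1 ≤ Φ r)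
    (hΦmono : MonotoneOn Φ (Set.Ici 0)) (hΦcont : ContinuousOn Φ (Set.Ici 0))
    (hΦscale : ∀ s r : ℝ, 0 < s → s ≤ r → Φ r ≤ C_Φ * (r / s) ^ β₁ * Φ s)
    (α : ℝ) (hα0 : 0 < α) (hα2 : α < 2) (A₀ : ℝ≥0∞) (hA₀ : 0 < A₀)
    (J : EuclideanSpace ℝ (Fin d) → EuclideanSpace ℝ (Fin d) → ℝ)
    (C₁ : ℝ) (hC₁ : 1 < C₁)
    (hJnn : ∀ x y, 0 ≤ J x y)
    (hJmeas : Measurable (Function.uncurry J))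
    (hJsym : ∀ x ∈ D, ∀ y ∈ D, J x y = J y x)
    (hJbound : ∀ x ∈ D, ∀ y ∈ D, x ≠ y →
      C₁⁻¹ * (dist x y ^ (-((d : ℝ) + α)) *
          Φ ((truncMin A₀ (dist x y)) ^ 2 /
            (truncMin A₀ (deltaD D x) * truncMin A₀ (deltaD D y)))) ≤ J x y ∧
      J x y ≤ C₁ * (dist x y ^ (-((d : ℝ) + α)) *
          Φ ((truncMin A₀ (dist x y)) ^ 2 /
            (truncMin A₀ (deltaD D x) * truncMin A₀ (deltaD D y)))))
    (lam : ℝ) (hlam0 : 0 ≤ lam) (hlamd : lam < (d : ℝ)) (hCov : CoveringCond D lam)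
    (q' : ℝ) (hq'0 : 0 < q') (hq'd : q' ≤ (d : ℝ)) (hAik : Aikawa D q')
    (hβ₁0 : 0 < β₁) (hβα : β₁ < α) (hβlam : β₁ < (d : ℝ) - lam) (hβq' : β₁ < q') :
    ∃ C : ℝ, 0 < C ∧ ∀ ρ : ℝ, 0 < ρ → ENNReal.ofReal ρ < EMetric.diam D →
      ∀ u : EuclideanSpace ℝ (Fin d) → ℝ, Measurable u →
        (∃ M : ℝ, ∀ x, |u x| ≤ M) → HasCompactSupport u →
      (∫⁻ p in D ×ˢ D, ENNReal.ofReal ((u p.1 - u p.2) ^ 2 * J p.1 p.2)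
          ∂(MeasureTheory.volume.prod MeasureTheory.volume)) ≤
        ENNReal.ofReal C *
          ((∫⁻ p in (D ×ˢ D) ∩ {p : EuclideanSpace ℝ (Fin d) × EuclideanSpace ℝ (Fin d) |
                dist p.1 p.2 < ρ},
              ENNReal.ofReal ((u p.1 - u p.2) ^ 2 * J p.1 p.2)
              ∂(MeasureTheory.volume.prod MeasureTheory.volume)) +
            (min (ENNReal.ofReal ρ) R₀) ^ (-α) *
              ∫⁻ x in D, ENNReal.ofReal (u x ^ 2)) := by
  obtain ⟨C, hC, hbound⟩ := exists_truncation_bound hd hDopen hfr hκ0 hκ1 hfat hβ₁ hC_Φ hΦ1 hΦmono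
    hΦcont hΦscale hβα hA₀ hC₁ hJmeas hJsym hJbound hCov hβlam
  refine ⟨C * 2 ^ α, by positivity, fun ρ hρ _ u hu _ _ => ?_⟩
  have hmin : min (ENNReal.ofReal ρ) R₀ ≠ ∞ := ((min_le_left _ _).trans_lt ofReal_lt_top).ne
  set R : ℝ := (min (ENNReal.ofReal ρ) R₀).toReal with hR
  have hR0 : 0 < R := ENNReal.toReal_pos (lt_min (ENNReal.ofReal_pos.2 hρ) hR₀0).ne' hmin
  have hRmin : ENNReal.ofReal R = min (ENNReal.ofReal ρ) R₀ := ENNReal.ofReal_toReal hmin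
  have hRρ : R ≤ ρ :=
    (ENNReal.ofReal_le_ofReal_iff hρ.le).1 (hRmin.trans_le (min_le_left _ _))
  have hrR : ENNReal.ofReal (R / 2) < R₀ :=
    ((ENNReal.ofReal_lt_ofReal_iff hR0).2 (by linarith)).trans_le
      (hRmin.trans_le (min_le_right _ _))
  have hscale : ENNReal.ofReal ((R / 2) ^ (-α)) =
      ENNReal.ofReal (2 ^ α) * (min (ENNReal.ofReal ρ) R₀) ^ (-α) := by
    rw [← hRmin, ENNReal.ofReal_rpow_of_pos hR0, ← ENNReal.ofReal_mul (by positivity),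
      Real.div_rpow hR0.le (by norm_num), Real.rpow_neg (by norm_num : (0 : ℝ) ≤ 2), div_inv_eq_mul,
      mul_comm]
  have h2α : 1 ≤ ENNReal.ofReal (2 ^ α) :=
    ENNReal.one_le_ofReal.2 (Real.one_le_rpow (by norm_num) hα0.le)
  refine (hbound (R / 2) (by positivity) hrR u hu).trans ?_
  rw [hscale, ENNReal.ofReal_mul hC.le, _root_.mul_assoc (ENNReal.ofReal C)]
  refine mul_le_mul_right ?_ _
  rw [_root_.mul_add, _root_.mul_assoc]
  refine add_le_add (le_trans ?_ (le_mul_of_one_le_left' h2α)) le_rfl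
  exact lintegral_mono_set (inter_subset_inter_right _ fun p (hp : dist p.1 p.2 < R / 2) =>
    show dist p.1 p.2 < ρ by linarith)
end

section
/- Let a₁ ≥ −d, a₂ ≥ −d and a₃ ≥ 0 be constants with a₃ < d + a₁ + a₂. Then there exists C > 0 such that for all x, y ∈ D, ∫_{D^c} δ_{D^c}(z)^{a₃} |x−z|^{−d−a₁} |z−y|^{−d−a₂} dz ≤ C ( f_{a₃−a₁,y}(x) (|x−y| + δ_D^∨(x,y))^{−d−a₂} + f_{a₃−a₂,x}(y) (|x−y| + δ_D^∨(x,y))^{−d−a₁} ). -/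
open MeasureTheory Metric Set ENNReal Filter

open Classical in
noncomputable def fgam {d : ℕ} (D : Set (EuclideanSpace ℝ (Fin d))) (γ : ℝ)
    (y x : EuclideanSpace ℝ (Fin d)) : ℝ :=
  if 0 < γ then (dist x y + max (deltaD D x) (deltaD D y)) ^ γ
  else if γ = 0 then Real.log (Real.exp 1 + dist x y / deltaD D x)
  else deltaD D x ^ γ

section Aux

lemma deltaD_le_dist {d : ℕ} {D : Set (EuclideanSpace ℝ (Fin d))} {x z : EuclideanSpace ℝ (Fin d)}
    (hx : x ∈ D) (hz : z ∉ D) : deltaD D x ≤ dist x z := by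
  obtain ⟨w, hw, h⟩ := exists_mem_frontier_infDist_compl_eq_dist hx
    (fun h => hz (h ▸ mem_univ z))
  exact (Metric.infDist_le_dist_of_mem hw).trans (h ▸ Metric.infDist_le_dist_of_mem hz)

lemma deltaD_le_dist_of_notMem {d : ℕ} {D : Set (EuclideanSpace ℝ (Fin d))}
    {x z : EuclideanSpace ℝ (Fin d)} (hx : x ∈ D) (hz : z ∉ D) : deltaD D z ≤ dist x z := by
  have := deltaD_le_dist (D := Dᶜ) (x := z) (z := x) hz (by simpa using hx)
  rwa [deltaD, frontier_compl, dist_comm] at this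

lemma deltaD_pos {d : ℕ} {D : Set (EuclideanSpace ℝ (Fin d))} (hD : IsOpen D)
    (hfr : (frontier D).Nonempty) {x : EuclideanSpace ℝ (Fin d)} (hx : x ∈ D) :
    0 < deltaD D x := by
  refine (isClosed_frontier.notMem_iff_infDist_pos hfr).1 fun h => ?_
  have : x ∈ D ∩ frontier D := ⟨hx, h⟩
  rw [hD.inter_frontier_eq] at this
  exact this

/-- Integration of a power of the distance over a spherically symmetric region. -/
lemma setLIntegral_dist_rpow {d : ℕ} (hd : 2 ≤ d) (x : EuclideanSpace ℝ (Fin d)) (p : ℝ)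
    {S : Set ℝ} (hS : MeasurableSet S) (hS0 : S ⊆ Ioi 0)
    (hint : IntegrableOn (fun t : ℝ => t ^ (p - 1)) S) :
    ∫⁻ z in {z | dist x z ∈ S}, ENNReal.ofReal (dist x z ^ (p - d)) =
      ENNReal.ofReal (d * volume.real (ball (0 : EuclideanSpace ℝ (Fin d)) 1) *
        ∫ t in S, t ^ (p - 1)) := by
  have : Nonempty (Fin d) := ⟨⟨0, by omega⟩⟩
  have : Nontrivial (EuclideanSpace ℝ (Fin d)) :=
    Module.nontrivial_of_finrank_pos (R := ℝ) (by simp; omega)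
  set f : ℝ → ℝ := S.indicator fun t => t ^ (p - d) with hf
  have hf0 : ∀ t, 0 ≤ f t := fun t =>
    indicator_nonneg (fun t ht => Real.rpow_nonneg (hS0 ht).le _) t
  have hrad : EqOn (fun t : ℝ => t ^ (Module.finrank ℝ (EuclideanSpace ℝ (Fin d)) - 1) • f t)
      (S.indicator fun t => t ^ (p - 1)) (Ioi 0) := by
    intro t (ht : 0 < t)
    by_cases hts : t ∈ S
    · simp only [hf, indicator_of_mem hts, smul_eq_mul, finrank_euclideanSpace, Fintype.card_fin]
      rw [← Real.rpow_natCast, ← Real.rpow_add ht, Nat.cast_sub (by omega)]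
      congr 1
      push_cast
      ring
    · simp [hf, hts]
  have hfint : Integrable (fun z : EuclideanSpace ℝ (Fin d) => f ‖z‖) := by
    rw [integrable_fun_norm_addHaar, integrableOn_congr_fun hrad measurableSet_Ioi]
    exact (hint.integrable_indicator hS).integrableOn
  have hval : ∫ z : EuclideanSpace ℝ (Fin d), f ‖z‖ =
      d * volume.real (ball (0 : EuclideanSpace ℝ (Fin d)) 1) * ∫ t in S, t ^ (p - 1) := by
    rw [integral_fun_norm_addHaar, setIntegral_congr_fun measurableSet_Ioi hrad,
      setIntegral_indicator hS, inter_eq_self_of_subset_right hS0]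
    simp [mul_assoc]
  have hmeas : MeasurableSet {z | dist x z ∈ S} :=
    (measurable_const.dist measurable_id) hS
  rw [← hval, ofReal_integral_eq_lintegral_ofReal hfint (.of_forall fun z => hf0 _),
    ← lintegral_sub_right_eq_self (fun z => ENNReal.ofReal (f ‖z‖)) x,
    ← lintegral_indicator hmeas]
  refine lintegral_congr fun z => ?_
  by_cases hz : dist x z ∈ S
  · rw [indicator_of_mem (show z ∈ {z | dist x z ∈ S} from hz), ← dist_eq_norm, dist_comm z x,
      hf, indicator_of_mem hz]
  · rw [indicator_of_notMem (show z ∉ {z | dist x z ∈ S} from hz), ← dist_eq_norm, dist_comm z x,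
      hf, indicator_of_notMem hz, ENNReal.ofReal_zero]

lemma integrableOn_Icc_rpow {a b : ℝ} (ha : 0 < a) (q : ℝ) :
    IntegrableOn (fun t : ℝ => t ^ q) (Icc a b) :=
  (continuousOn_id.rpow_const fun _ ht => Or.inl (ha.trans_le ht.1).ne').integrableOn_Icc

lemma fgam_pos {d : ℕ} {D : Set (EuclideanSpace ℝ (Fin d))} {x y : EuclideanSpace ℝ (Fin d)}
    (hx : 0 < deltaD D x) (γ : ℝ) : 0 < fgam D γ y x := by
  unfold fgam
  split_ifs
  · exact Real.rpow_pos_of_pos (add_pos_of_nonneg_of_pos dist_nonneg (lt_max_of_lt_left hx)) _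
  · refine Real.log_pos ?_
    have : 0 ≤ dist x y / deltaD D x := by positivity
    linarith [Real.exp_one_gt_two]
  · exact Real.rpow_pos_of_pos hx _

lemma rpow_le_fgam {d : ℕ} {D : Set (EuclideanSpace ℝ (Fin d))} {x y : EuclideanSpace ℝ (Fin d)}
    (hx : 0 < deltaD D x) (γ : ℝ) :
    (dist x y + max (deltaD D x) (deltaD D y)) ^ γ ≤ fgam D γ y x := by
  have hR : deltaD D x ≤ dist x y + max (deltaD D x) (deltaD D y) :=
    (le_max_left _ _).trans (le_add_of_nonneg_left dist_nonneg)
  unfold fgam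
  split_ifs with h h'
  · exact le_rfl
  · rw [h', Real.rpow_zero, Real.le_log_iff_exp_le (by positivity)]
    have : 0 ≤ dist x y / deltaD D x := by positivity
    linarith
  · exact Real.rpow_le_rpow_of_nonpos hx hR (not_lt.1 h)

lemma exists_integral_Icc_rpow_le_fgam {d : ℕ} (D : Set (EuclideanSpace ℝ (Fin d))) (γ : ℝ) :
    ∃ C : ℝ, 0 < C ∧ ∀ x y, 0 < deltaD D x →
      ∫ t in Icc (deltaD D x) (dist x y + max (deltaD D x) (deltaD D y)), t ^ (γ - 1) ≤
        C * fgam D γ y x := by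
  have hR (x y : EuclideanSpace ℝ (Fin d)) :
      deltaD D x ≤ dist x y + max (deltaD D x) (deltaD D y) :=
    (le_max_left _ _).trans (le_add_of_nonneg_left dist_nonneg)
  have hnot (x y : EuclideanSpace ℝ (Fin d)) (hx : 0 < deltaD D x) :
      (0 : ℝ) ∉ uIcc (deltaD D x) (dist x y + max (deltaD D x) (deltaD D y)) :=
    notMem_uIcc_of_lt hx (hx.trans_le (hR x y))
  have hne : γ ≠ 0 → γ - 1 ≠ -1 := fun h h' => h (by linarith)
  rcases lt_trichotomy γ 0 with h | h | h
  · refine ⟨(-γ)⁻¹, by simpa using h, fun x y hx => ?_⟩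
    rw [integral_Icc_eq_integral_Ioc, ← intervalIntegral.integral_of_le (hR x y),
      integral_rpow (Or.inr ⟨hne h.ne, hnot x y hx⟩), sub_add_cancel, fgam, if_neg h.not_gt,
      if_neg h.ne, inv_mul_eq_div, ← neg_div_neg_eq]
    refine div_le_div_of_nonneg_right ?_ (by linarith)
    linarith [Real.rpow_nonneg (hx.le.trans (hR x y)) γ]
  · refine ⟨2, two_pos, fun x y hx => ?_⟩
    subst h
    have hu : 0 ≤ dist x y / deltaD D x := by positivity
    have hlip : deltaD D y ≤ deltaD D x + dist x y := by
      rw [dist_comm]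
      exact Metric.infDist_le_infDist_add_dist
    have hmax : max (deltaD D x) (deltaD D y) ≤ deltaD D x + dist x y :=
      max_le (le_add_of_nonneg_right dist_nonneg) hlip
    simp_rw [zero_sub, Real.rpow_neg_one]
    rw [integral_Icc_eq_integral_Ioc, ← intervalIntegral.integral_of_le (hR x y),
      integral_inv (hnot x y hx), fgam, if_neg (lt_irrefl _), if_pos rfl, ← Real.log_rpow (by positivity)]
    refine Real.log_le_log (div_pos (hx.trans_le (hR x y)) hx) ?_
    have he := Real.exp_one_gt_two
    have : (dist x y + max (deltaD D x) (deltaD D y)) / deltaD D x ≤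
        1 + 2 * (dist x y / deltaD D x) := by
      rw [div_le_iff₀ hx]
      field_simp
      linarith
    refine this.trans ?_
    rw [Real.rpow_two]
    nlinarith
  · refine ⟨γ⁻¹, by simpa using h, fun x y hx => ?_⟩
    rw [integral_Icc_eq_integral_Ioc, ← intervalIntegral.integral_of_le (hR x y),
      integral_rpow (Or.inr ⟨hne h.ne', hnot x y hx⟩), sub_add_cancel, fgam, if_pos h,
      inv_mul_eq_div]
    refine div_le_div_of_nonneg_right ?_ h.le
    linarith [Real.rpow_nonneg hx.le γ]

/-- The part of the integral over the points of `Dᶜ` that are closer to `x` than to `y`. -/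
lemma exists_setLIntegral_closer_le {d : ℕ} (hd : 2 ≤ d) (D : Set (EuclideanSpace ℝ (Fin d)))
    (hDopen : IsOpen D) (hfr : (frontier D).Nonempty)
    (a₁ a₂ a₃ : ℝ) (ha₂ : -(d : ℝ) ≤ a₂) (ha₃ : 0 ≤ a₃) (ha : a₃ < (d : ℝ) + a₁ + a₂) :
    ∃ C : ℝ, 0 < C ∧ ∀ x ∈ D, ∀ y ∈ D,
      (∫⁻ z in Dᶜ ∩ {z | dist x z ≤ dist z y},
          ENNReal.ofReal (deltaD D z ^ a₃ * dist x z ^ (-((d : ℝ) + a₁)) *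
            dist z y ^ (-((d : ℝ) + a₂)))) ≤
        ENNReal.ofReal (C * (fgam D (a₃ - a₁) y x *
          (dist x y + max (deltaD D x) (deltaD D y)) ^ (-((d : ℝ) + a₂)))) := by
  obtain ⟨C₁, hC₁, hC₁'⟩ := exists_integral_Icc_rpow_le_fgam D (a₃ - a₁)
  set ω : ℝ := d * volume.real (ball (0 : EuclideanSpace ℝ (Fin d)) 1) with hω
  have hω0 : 0 ≤ ω := by positivity
  set b : ℝ := d + a₂ with hb
  have hb0 : 0 ≤ b := by linarith
  set p : ℝ := a₃ - a₁ - b with hp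
  have hp0 : p < 0 := by linarith
  refine ⟨3 ^ b * ω * C₁ + ω * (-p)⁻¹ + 1, by
    have : 0 < (-p)⁻¹ := by simpa using hp0
    positivity, fun x hx y hy => ?_⟩
  have hδ := deltaD_pos hDopen hfr hx
  have hfx := fgam_pos (y := y) hδ (a₃ - a₁)
  have hRle := rpow_le_fgam (y := y) hδ (a₃ - a₁)
  have hI := hC₁' x y hδ
  set R : ℝ := dist x y + max (deltaD D x) (deltaD D y) with hR
  have hδR : deltaD D x ≤ R := (le_max_left _ _).trans (le_add_of_nonneg_left dist_nonneg)
  have hR0 : 0 < R := hδ.trans_le hδR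
  set F : EuclideanSpace ℝ (Fin d) → ℝ := fun z =>
    deltaD D z ^ a₃ * dist x z ^ (-((d : ℝ) + a₁)) * dist z y ^ (-b) with hF
  set T := Dᶜ ∩ {z | dist x z ≤ dist z y} with hT
  have hTm : MeasurableSet T := hDopen.measurableSet.compl.inter
    (isClosed_le (by fun_prop) (by fun_prop)).measurableSet
  have hdm (S : Set ℝ) (hS : MeasurableSet S) : MeasurableSet {z | dist x z ∈ S} :=
    (measurable_const.dist measurable_id) hS
  have hfactor (z) (hz : z ∈ T) :
      0 < dist x z ∧ deltaD D z ^ a₃ * dist x z ^ (-((d : ℝ) + a₁)) ≤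
        dist x z ^ (a₃ - a₁ - d) := by
    have h0 : 0 < dist x z := hδ.trans_le (deltaD_le_dist hx hz.1)
    refine ⟨h0, ?_⟩
    calc deltaD D z ^ a₃ * dist x z ^ (-((d : ℝ) + a₁))
        ≤ dist x z ^ a₃ * dist x z ^ (-((d : ℝ) + a₁)) := by
          gcongr
          · exact Metric.infDist_nonneg
          · exact deltaD_le_dist_of_notMem hx hz.1
      _ = dist x z ^ (a₃ - a₁ - d) := by
          rw [← Real.rpow_add h0]
          ring_nf
  have hnear : ∫⁻ z in T ∩ {z | dist x z ∈ Icc (deltaD D x) R}, ENNReal.ofReal (F z) ≤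
      ENNReal.ofReal (3 ^ b * R ^ (-b) * (ω * ∫ t in Icc (deltaD D x) R, t ^ (a₃ - a₁ - 1))) := by
    have hpt (z) (hz : z ∈ T ∩ {z | dist x z ∈ Icc (deltaD D x) R}) :
        ENNReal.ofReal (F z) ≤ ENNReal.ofReal (3 ^ b * R ^ (-b)) *
          ENNReal.ofReal (dist x z ^ (a₃ - a₁ - d)) := by
      obtain ⟨h0, h1⟩ := hfactor z hz.1
      rw [← ENNReal.ofReal_mul (by positivity)]
      refine ENNReal.ofReal_le_ofReal ?_
      have hle : dist x z ≤ dist z y := hz.1.2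
      have hR3 : R / 3 ≤ dist z y := by
        have h2 := dist_triangle x z y
        have h3 := deltaD_le_dist hx hz.1.1
        have h4 := deltaD_le_dist hy hz.1.1
        rw [dist_comm y z] at h4
        have h5 : max (deltaD D x) (deltaD D y) ≤ dist z y := max_le (h3.trans hle) h4
        rw [hR]
        linarith
      have h6 : dist z y ^ (-b) ≤ 3 ^ b * R ^ (-b) := by
        refine (Real.rpow_le_rpow_of_nonpos (by positivity) hR3 (by linarith)).trans_eq ?_
        rw [Real.div_rpow hR0.le (by norm_num), Real.rpow_neg (by norm_num : (0:ℝ) ≤ 3),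
          div_inv_eq_mul, mul_comm]
      rw [mul_comm (3 ^ b * R ^ (-b))]
      exact mul_le_mul h1 h6 (by positivity) (by positivity)
    refine (setLIntegral_mono' (hTm.inter (hdm _ measurableSet_Icc)) hpt).trans ?_
    refine (lintegral_mono_set inter_subset_right).trans ?_
    rw [lintegral_const_mul _ (by fun_prop), setLIntegral_dist_rpow hd x _ measurableSet_Icc
      (fun t ht => hδ.trans_le ht.1) (integrableOn_Icc_rpow hδ _),
      ← ENNReal.ofReal_mul (by positivity)]
  have hfar : ∫⁻ z in T ∩ {z | dist x z ∈ Ioi R}, ENNReal.ofReal (F z) ≤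
      ENNReal.ofReal (ω * ∫ t in Ioi R, t ^ (p - 1)) := by
    have hpt (z) (hz : z ∈ T ∩ {z | dist x z ∈ Ioi R}) :
        ENNReal.ofReal (F z) ≤ ENNReal.ofReal (dist x z ^ (p - d)) := by
      obtain ⟨h0, h1⟩ := hfactor z hz.1
      refine ENNReal.ofReal_le_ofReal ?_
      refine (mul_le_mul h1 (Real.rpow_le_rpow_of_nonpos h0 hz.1.2 (by linarith : -b ≤ 0))
        (by positivity) (by positivity)).trans_eq ?_
      rw [← Real.rpow_add h0, hp]
      ring_nf
    refine (setLIntegral_mono' (hTm.inter (hdm _ measurableSet_Ioi)) hpt).trans ?_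
    refine (lintegral_mono_set inter_subset_right).trans ?_
    rw [setLIntegral_dist_rpow hd x _ measurableSet_Ioi
      (Ioi_subset_Ioi hR0.le) (integrableOn_Ioi_rpow_of_lt (by linarith) hR0)]
  have hcover : T ⊆ (T ∩ {z | dist x z ∈ Icc (deltaD D x) R}) ∪
      (T ∩ {z | dist x z ∈ Ioi R}) := by
    intro z hz
    rcases le_or_gt (dist x z) R with h | h
    · exact Or.inl ⟨hz, deltaD_le_dist hx hz.1, h⟩
    · exact Or.inr ⟨hz, h⟩
  refine (lintegral_mono_set hcover).trans <| (lintegral_union_le _ _ _).trans <|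
    (add_le_add hnear hfar).trans ?_
  have hI0 : 0 ≤ ∫ t in Icc (deltaD D x) R, t ^ (a₃ - a₁ - 1) :=
    setIntegral_nonneg measurableSet_Icc fun t ht => Real.rpow_nonneg (hδ.le.trans ht.1) _
  have hJ0 : 0 ≤ ∫ t in Ioi R, t ^ (p - 1) :=
    setIntegral_nonneg measurableSet_Ioi fun t ht => Real.rpow_nonneg (hR0.trans ht).le _
  rw [← ENNReal.ofReal_add (by positivity) (by positivity)]
  refine ENNReal.ofReal_le_ofReal ?_
  have hJ : ∫ t in Ioi R, t ^ (p - 1) ≤ (-p)⁻¹ * (fgam D (a₃ - a₁) y x * R ^ (-b)) := by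
    rw [integral_Ioi_rpow_of_lt (by linarith) hR0, sub_add_cancel, neg_div, ← div_neg,
      inv_mul_eq_div]
    refine div_le_div_of_nonneg_right ?_ (by linarith)
    rw [show p = a₃ - a₁ + -b by rw [hp]; ring, Real.rpow_add hR0]
    gcongr
  have hRb : 0 < R ^ (-b) := by positivity
  calc 3 ^ b * R ^ (-b) * (ω * ∫ t in Icc (deltaD D x) R, t ^ (a₃ - a₁ - 1)) +
        ω * ∫ t in Ioi R, t ^ (p - 1)
      ≤ 3 ^ b * R ^ (-b) * (ω * (C₁ * fgam D (a₃ - a₁) y x)) +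
        ω * ((-p)⁻¹ * (fgam D (a₃ - a₁) y x * R ^ (-b))) := by gcongr
    _ ≤ (3 ^ b * ω * C₁ + ω * (-p)⁻¹ + 1) * (fgam D (a₃ - a₁) y x * R ^ (-b)) := by
      nlinarith [mul_pos hfx hRb]

end Aux

theorem stmt16 {d : ℕ} (hd : 2 ≤ d) (D : Set (EuclideanSpace ℝ (Fin d)))
    (hDopen : IsOpen D) (hDne : D.Nonempty) (hfr : (frontier D).Nonempty)
    (a₁ a₂ a₃ : ℝ) (ha₁ : -(d : ℝ) ≤ a₁) (ha₂ : -(d : ℝ) ≤ a₂) (ha₃ : 0 ≤ a₃)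
    (ha : a₃ < (d : ℝ) + a₁ + a₂) :
    ∃ C : ℝ, 0 < C ∧ ∀ x ∈ D, ∀ y ∈ D,
      (∫⁻ z in Dᶜ,
          ENNReal.ofReal (deltaD D z ^ a₃ * dist x z ^ (-((d : ℝ) + a₁)) *
            dist z y ^ (-((d : ℝ) + a₂)))) ≤
        ENNReal.ofReal (C *
          (fgam D (a₃ - a₁) y x *
              (dist x y + max (deltaD D x) (deltaD D y)) ^ (-((d : ℝ) + a₂)) +
            fgam D (a₃ - a₂) x y *
              (dist x y + max (deltaD D x) (deltaD D y)) ^ (-((d : ℝ) + a₁)))) := by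
  obtain ⟨C₁, hC₁, h₁⟩ := exists_setLIntegral_closer_le hd D hDopen hfr a₁ a₂ a₃ ha₂ ha₃ ha
  obtain ⟨C₂, hC₂, h₂⟩ := exists_setLIntegral_closer_le hd D hDopen hfr a₂ a₁ a₃ ha₁ ha₃
    (by linarith)
  refine ⟨max C₁ C₂, lt_max_of_lt_left hC₁, fun x hx y hy => ?_⟩
  have k₁ := h₁ x hx y hy
  have k₂ := h₂ y hy x hx
  have hfx := fgam_pos (y := y) (deltaD_pos hDopen hfr hx) (a₃ - a₁)
  have hfy := fgam_pos (y := x) (deltaD_pos hDopen hfr hy) (a₃ - a₂)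
  rw [dist_comm y x, max_comm (deltaD D y)] at k₂
  have hR : 0 < dist x y + max (deltaD D x) (deltaD D y) :=
    add_pos_of_nonneg_of_pos dist_nonneg (lt_max_of_lt_left (deltaD_pos hDopen hfr hx))
  have hcover : Dᶜ ⊆ (Dᶜ ∩ {z | dist x z ≤ dist z y}) ∪ (Dᶜ ∩ {z | dist y z ≤ dist z x}) := by
    intro z hz
    rcases le_total (dist x z) (dist z y) with h | h
    · exact Or.inl ⟨hz, h⟩
    · exact Or.inr ⟨hz, by rwa [mem_ofPred_eq, dist_comm y z, dist_comm z x]⟩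
  refine (lintegral_mono_set hcover).trans <| (lintegral_union_le _ _ _).trans ?_
  have hsymm (z : EuclideanSpace ℝ (Fin d)) :
      deltaD D z ^ a₃ * dist y z ^ (-((d : ℝ) + a₂)) * dist z x ^ (-((d : ℝ) + a₁)) =
        deltaD D z ^ a₃ * dist x z ^ (-((d : ℝ) + a₁)) * dist z y ^ (-((d : ℝ) + a₂)) := by
    rw [dist_comm y z, dist_comm z x]
    ring
  simp_rw [hsymm] at k₂
  refine (add_le_add k₁ k₂).trans ?_
  rw [← ENNReal.ofReal_add (by positivity) (by positivity), mul_add]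
  gcongr
  · exact le_max_left _ _
  · exact le_max_right _ _
end
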